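/- arXiv:math/0208068 — 5 statements merged into one kernel-verified Lean document; each statement's English description precedes it below -/
import Mathlib

section
/- There exists an injective ℝ-linear map γ : C₀(ℝ, ℂ) → T preserving multiplication and star whose range is exactly the kernel of the evaluation map ζ : T → ℂ, ζ(f) = f(0); that is, the suspension S ℂ = C₀(ℝ, ℂ) fits into a short exact sequence 0 → S ℂ → T → ℂ → 0 of real C*-algebras. -/
open scoped ZeroAtInfty

/-- The real C*-algebra `T = {f ∈ C(I, ℂ) : f 0 = conj (f 1)}`. -/
def T : Set C(unitInterval, ℂ) := {f | f 0 = (starRingEnd ℂ) (f 1)}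

open Filter Function Topology

section ExtendByZero

variable {X Y β : Type*} [TopologicalSpace X] [TopologicalSpace Y] [TopologicalSpace β] [Zero β]
  {e : X → Y}

/-- A function vanishing at infinity extends continuously by zero along an open embedding. -/
theorem ZeroAtInftyContinuousMap.continuous_extend_zero [T2Space Y] (he : IsOpenEmbedding e)
    (f : C₀(X, β)) : Continuous (extend e f 0) := by
  rw [continuous_iff_continuousAt]
  intro y
  by_cases hy : ∃ x, e x = y
  · obtain ⟨x, rfl⟩ := hy
    rw [← he.continuousAt_iff, Function.extend_comp he.injective]
    exact (map_continuous f).continuousAt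
  · rw [ContinuousAt, extend_apply' _ _ _ hy]
    intro s hs
    obtain ⟨C, hC, hCs⟩ := mem_cocompact.mp (f.zero_at_infty' hs)
    have hyC : y ∉ e '' C := fun ⟨x, _, hx⟩ => hy ⟨x, hx⟩
    rw [mem_map]
    filter_upwards [(hC.image he.continuous).isClosed.isOpen_compl.mem_nhds hyC] with z hz
    by_cases hz' : ∃ x, e x = z
    · obtain ⟨x, rfl⟩ := hz'
      rw [Set.mem_preimage, he.injective.extend_apply]
      exact hCs fun hx => hz ⟨x, hx, rfl⟩
    · rw [Set.mem_preimage, extend_apply' _ _ _ hz']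
      exact mem_of_mem_nhds hs

/-- Extension by zero along an open embedding, as a continuous map. -/
noncomputable def ZeroAtInftyContinuousMap.extendZero [T2Space Y] (he : IsOpenEmbedding e)
    (f : C₀(X, β)) : C(Y, β) :=
  ⟨extend e f 0, f.continuous_extend_zero he⟩

theorem ZeroAtInftyContinuousMap.extendZero_apply [T2Space Y] (he : IsOpenEmbedding e)
    (f : C₀(X, β)) (x : X) : f.extendZero he (e x) = f x :=
  he.injective.extend_apply _ _ _

theorem ZeroAtInftyContinuousMap.extendZero_of_notMem_range [T2Space Y] (he : IsOpenEmbedding e)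
    (f : C₀(X, β)) {y : Y} (hy : y ∉ Set.range e) : f.extendZero he y = 0 :=
  extend_apply' _ _ _ hy

/-- A continuous function on a compact space that vanishes outside the range of an embedding
pulls back to a function vanishing at infinity. -/
theorem Topology.IsEmbedding.tendsto_comp_cocompact_zero [CompactSpace Y] (he : IsEmbedding e)
    (g : C(Y, β)) (hg : ∀ y ∉ Set.range e, g y = 0) :
    Tendsto (g ∘ e) (cocompact X) (𝓝 0) := by
  intro s hs
  obtain ⟨u, hus, hu, h0⟩ := mem_nhds_iff.mp hs
  have hK : IsCompact (g ⁻¹' uᶜ) := (hu.isClosed_compl.preimage g.continuous).isCompact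
  have hr : g ⁻¹' uᶜ ⊆ Set.range e := fun y hy => by
    by_contra h
    exact hy (by rwa [hg y h])
  refine mem_cocompact'.mpr ⟨e ⁻¹' (g ⁻¹' uᶜ), he.isInducing.isCompact_preimage' hK hr, ?_⟩
  exact fun x hx hxu => hx (hus hxu)

theorem ZeroAtInftyContinuousMap.range_extendZero [T2Space Y] [CompactSpace Y]
    (he : IsOpenEmbedding e) :
    Set.range (extendZero he : C₀(X, β) → C(Y, β)) = {g | ∀ y ∉ Set.range e, g y = 0} := by
  ext g
  constructor
  · rintro ⟨f, rfl⟩ y hy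
    exact f.extendZero_of_notMem_range he hy
  · intro hg
    refine ⟨⟨⟨g ∘ e, g.continuous.comp he.continuous⟩,
      he.isEmbedding.tendsto_comp_cocompact_zero g hg⟩, ?_⟩
    ext y
    by_cases hy : y ∈ Set.range e
    · obtain ⟨x, rfl⟩ := hy
      exact extendZero_apply he _ x
    · rw [extendZero_of_notMem_range he _ hy, hg y hy]

theorem ZeroAtInftyContinuousMap.extendZero_injective [T2Space Y] (he : IsOpenEmbedding e) :
    Injective (extendZero he : C₀(X, β) → C(Y, β)) := fun f g h => by
  ext x
  rw [← extendZero_apply he f, h, extendZero_apply]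

end ExtendByZero

theorem unitInterval.isOpenEmbedding_sigmoid : IsOpenEmbedding unitInterval.sigmoid where
  toIsEmbedding := isEmbedding_sigmoid
  isOpen_range := by rw [unitInterval.range_sigmoid]; exact isOpen_Ioo

theorem unitInterval.notMem_range_sigmoid {t : unitInterval} :
    t ∉ Set.range unitInterval.sigmoid ↔ t = 0 ∨ t = 1 := by
  rw [unitInterval.range_sigmoid, Set.mem_Ioo, unitInterval.pos_iff_ne_zero,
    unitInterval.lt_one_iff_ne_one]
  tauto

/-- There is an injective `ℝ`-linear map `γ : C₀(ℝ, ℂ) → T` preserving multiplication and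
star whose range is exactly the kernel of the evaluation `ζ : T → ℂ`, `ζ f = f 0`; i.e.
`0 → S ℂ → T → ℂ → 0` is a short exact sequence of real C*-algebras. -/
theorem stmt_4 :
    ∃ γ : C₀(ℝ, ℂ) → C(unitInterval, ℂ),
      Function.Injective γ ∧
      (∀ f, γ f ∈ T) ∧
      (∀ f g : C₀(ℝ, ℂ), γ (f + g) = γ f + γ g) ∧
      (∀ (r : ℝ) (f : C₀(ℝ, ℂ)), γ (r • f) = r • γ f) ∧
      (∀ f g : C₀(ℝ, ℂ), γ (f * g) = γ f * γ g) ∧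
      (∀ f : C₀(ℝ, ℂ), γ (star f) = star (γ f)) ∧
      Set.range γ = {f : C(unitInterval, ℂ) | f ∈ T ∧ f 0 = 0} := by
  have he := unitInterval.isOpenEmbedding_sigmoid
  have ext_of {g h : C(unitInterval, ℂ)}
      (h₁ : ∀ x, g (unitInterval.sigmoid x) = h (unitInterval.sigmoid x))
      (h₂ : ∀ t ∉ Set.range unitInterval.sigmoid, g t = h t) : g = h := by
    ext t
    by_cases ht : t ∈ Set.range unitInterval.sigmoid
    · obtain ⟨x, rfl⟩ := ht
      exact h₁ x
    · exact h₂ t ht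
  have hrange : Set.range (ZeroAtInftyContinuousMap.extendZero he : C₀(ℝ, ℂ) → _) =
      {f : C(unitInterval, ℂ) | f ∈ T ∧ f 0 = 0} := by
    rw [ZeroAtInftyContinuousMap.range_extendZero]
    ext g
    simp only [unitInterval.notMem_range_sigmoid, forall_eq_or_imp, forall_eq, T,
      Set.mem_ofPred_eq]
    constructor
    · rintro ⟨h0, h1⟩
      simp [h0, h1]
    · rintro ⟨h, h0⟩
      rw [h0] at h
      exact ⟨h0, (map_eq_zero _).mp h.symm⟩
  refine ⟨ZeroAtInftyContinuousMap.extendZero he,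
    ZeroAtInftyContinuousMap.extendZero_injective he,
    fun f => (hrange.subset ⟨f, rfl⟩).1, fun f g => ?_, fun r f => ?_, fun f g => ?_,
    fun f => ?_, hrange⟩
  all_goals
    refine ext_of (fun x => ?_) fun t ht => ?_
    · simp [ZeroAtInftyContinuousMap.extendZero_apply]
    · simp [ZeroAtInftyContinuousMap.extendZero_of_notMem_range he _ ht]
end

section
/- The real C*-algebra Cc = {f ∈ C(I, ℂ) : f(0) is real and f(1) = 0} (the mapping cone of the unital inclusion c : ℝ → ℂ) is star ℝ-algebra isomorphic to S⁻¹ = {f ∈ C₀(ℝ, ℂ) : f(−x) = conj(f(x)) for all x ∈ ℝ}. -/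
open scoped ZeroAtInfty

/-- The mapping cone `Cc = {f ∈ C(I, ℂ) : f 0 is real and f 1 = 0}` of `ℝ → ℂ`. -/
def Cc : Set C(unitInterval, ℂ) := {f | (f 0).im = 0 ∧ f 1 = 0}

/-- The real C*-algebra `S⁻¹ = {f ∈ C₀(ℝ, ℂ) : f (−x) = conj (f x)}`. -/
def Sinv : Set C₀(ℝ, ℂ) := {f | ∀ x : ℝ, f (-x) = (starRingEnd ℂ) (f x)}

open Filter Topology

namespace MappingCone

/-- The map `x ↦ |x| / (1 + |x|)` folding the real line onto `[0, 1)`. -/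
noncomputable def fold (x : ℝ) : unitInterval :=
  ⟨|x| / (1 + |x|), by positivity, by
    rw [div_le_one (by positivity)]
    linarith⟩

lemma coe_fold (x : ℝ) : (fold x : ℝ) = |x| / (1 + |x|) := rfl

lemma fold_neg (x : ℝ) : fold (-x) = fold x := by
  simp [fold]

lemma fold_zero : fold 0 = 0 := by
  ext
  simp [coe_fold]

lemma continuous_fold : Continuous fold := by
  refine Continuous.subtype_mk (continuous_abs.div (by fun_prop) fun x => ?_) _
  positivity

lemma tendsto_fold : Tendsto fold (cocompact ℝ) (𝓝 1) := by
  rw [tendsto_subtype_rng]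
  have h : Tendsto (fun x : ℝ => 1 - (1 + |x|)⁻¹) (cocompact ℝ) (𝓝 (1 - 0)) :=
    tendsto_const_nhds.sub
      ((tendsto_atTop_add_const_left _ 1 (tendsto_norm_cocompact_atTop (E := ℝ))).inv_tendsto_atTop)
  rw [sub_zero] at h
  refine h.congr fun x => ?_
  have : 1 + |x| ≠ 0 := by positivity
  rw [coe_fold]
  field_simp
  ring

lemma fold_ne_one (x : ℝ) : fold x ≠ 1 := by
  intro h
  have h' : |x| / (1 + |x|) = 1 := congrArg Subtype.val h
  rw [div_eq_one_iff_eq (by positivity)] at h'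
  linarith

/-- The map `t ↦ t / (1 - t)` stretching `[0, 1)` onto `[0, ∞)`. -/
noncomputable def stretch (t : unitInterval) : ℝ := t / (1 - t)

lemma one_sub_pos {t : unitInterval} (ht : t ≠ 1) : 0 < 1 - (t : ℝ) :=
  sub_pos.2 (unitInterval.lt_one_iff_ne_one.2 ht)

lemma stretch_nonneg (t : unitInterval) : 0 ≤ stretch t :=
  div_nonneg t.2.1 (sub_nonneg.2 t.2.2)

lemma stretch_zero : stretch 0 = 0 := by simp [stretch]

lemma fold_stretch {t : unitInterval} (ht : t ≠ 1) : fold (stretch t) = t := by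
  ext
  rw [coe_fold, abs_of_nonneg (stretch_nonneg t), stretch]
  have := (one_sub_pos ht).ne'
  field_simp
  ring

lemma stretch_fold (x : ℝ) : stretch (fold x) = |x| := by
  rw [stretch, coe_fold]
  have : 1 + |x| ≠ 0 := by positivity
  have h : 1 - |x| / (1 + |x|) = (1 + |x|)⁻¹ := by
    field_simp
    ring
  rw [h]
  field_simp

lemma continuousAt_stretch {t : unitInterval} (ht : t ≠ 1) : ContinuousAt stretch t :=
  ContinuousAt.div (by fun_prop) (by fun_prop) (one_sub_pos ht).ne'

lemma tendsto_stretch : Tendsto stretch (𝓝[≠] 1) atTop := by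
  have hsub : Tendsto (fun t : unitInterval => 1 - (t : ℝ)) (𝓝[≠] 1) (𝓝[>] 0) := by
    refine tendsto_nhdsWithin_iff.2 ⟨tendsto_nhdsWithin_of_tendsto_nhds ?_, ?_⟩
    · have h : Continuous fun t : unitInterval => 1 - (t : ℝ) := by fun_prop
      simpa using h.tendsto 1
    · filter_upwards [self_mem_nhdsWithin] with t ht using one_sub_pos ht
  have hcoe : Tendsto (fun t : unitInterval => (t : ℝ)) (𝓝[≠] 1) (𝓝 1) :=
    tendsto_nhdsWithin_of_tendsto_nhds (continuous_subtype_val.tendsto 1)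
  exact hcoe.pos_mul_atTop one_pos hsub.inv_tendsto_nhdsGT_zero

/-- The extension of `f ∘ fold` from `[0, ∞)` to the real line by `g (-x) = conj (g x)`. -/
noncomputable def unfoldFun (f : C(unitInterval, ℂ)) (x : ℝ) : ℂ :=
  if 0 ≤ x then f (fold x) else starRingEnd ℂ (f (fold x))

lemma continuous_unfoldFun {f : C(unitInterval, ℂ)} (hf : (f 0).im = 0) :
    Continuous (unfoldFun f) := by
  have h : Continuous fun x => f (fold x) := f.continuous.comp continuous_fold
  refine Continuous.if_le h (Complex.continuous_conj.comp h) continuous_const continuous_id ?_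
  rintro x rfl
  rw [fold_zero]
  exact (Complex.conj_eq_iff_im.2 hf).symm

lemma tendsto_unfoldFun {f : C(unitInterval, ℂ)} (hf : f 1 = 0) :
    Tendsto (unfoldFun f) (cocompact ℝ) (𝓝 0) := by
  have h : Tendsto (fun x => f (fold x)) (cocompact ℝ) (𝓝 0) :=
    hf ▸ (f.continuous.tendsto 1).comp tendsto_fold
  refine squeeze_zero_norm (fun x => le_of_eq ?_) (tendsto_zero_iff_norm_tendsto_zero.1 h)
  unfold unfoldFun
  split_ifs <;> simp

lemma unfoldFun_neg {f : C(unitInterval, ℂ)} (hf : (f 0).im = 0) (x : ℝ) :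
    unfoldFun f (-x) = starRingEnd ℂ (unfoldFun f x) := by
  unfold unfoldFun
  rw [fold_neg]
  rcases lt_trichotomy x 0 with hx | rfl | hx
  · simp [hx.le, hx.not_ge]
  · simpa [fold_zero] using (Complex.conj_eq_iff_im.2 hf).symm
  · simp [hx.le, hx.not_ge]

/-- The isomorphism from `Cc` to `Sinv`. -/
noncomputable def toSinv (f : Cc) : Sinv :=
  ⟨⟨⟨unfoldFun f, continuous_unfoldFun f.2.1⟩, tendsto_unfoldFun f.2.2⟩, unfoldFun_neg f.2.1⟩

lemma toSinv_apply (f : Cc) (x : ℝ) :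
    (toSinv f : C₀(ℝ, ℂ)) x =
      if 0 ≤ x then (f : C(unitInterval, ℂ)) (fold x)
      else starRingEnd ℂ ((f : C(unitInterval, ℂ)) (fold x)) := rfl

lemma continuous_update_comp_stretch (g : C₀(ℝ, ℂ)) :
    Continuous (Function.update (fun t => g (stretch t)) 1 0) := by
  refine continuous_iff_continuousAt.2 fun t => ?_
  rcases eq_or_ne t 1 with rfl | ht
  · exact continuousAt_update_same.2
      (g.zero_at_infty'.comp (tendsto_stretch.mono_right atTop_le_cocompact))
  · exact (continuousAt_update_of_ne ht).2
      (ContinuousAt.comp g.continuous.continuousAt (continuousAt_stretch ht))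

lemma toSinv_injective : Function.Injective toSinv := by
  intro f g h
  ext t
  rcases eq_or_ne t 1 with rfl | ht
  · rw [f.2.2, g.2.2]
  · have := DFunLike.congr_fun (congrArg Subtype.val h) (stretch t)
    simpa [toSinv_apply, stretch_nonneg, fold_stretch ht] using this

lemma toSinv_surjective : Function.Surjective toSinv := by
  intro g
  have h0 : ((g : C₀(ℝ, ℂ)) 0).im = 0 :=
    Complex.conj_eq_iff_im.1 (by simpa using (g.2 0).symm)
  refine ⟨⟨⟨_, continuous_update_comp_stretch g⟩, ?_, ?_⟩, ?_⟩
  · simpa [Function.update_of_ne, stretch_zero] using h0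
  · simp
  · ext x
    simp only [toSinv_apply, ContinuousMap.coe_mk, Function.update_of_ne (fold_ne_one x),
      stretch_fold]
    split_ifs with hx
    · rw [abs_of_nonneg hx]
    · rw [abs_of_neg (not_le.1 hx), g.2 x, Complex.conj_conj]

end MappingCone

/-- `Cc` is star `ℝ`-algebra isomorphic to `S⁻¹`: there is a bijection between them
which is `ℝ`-linear and preserves multiplication and star. -/
theorem stmt_5 :
    ∃ Φ : ↥Cc → ↥Sinv,
      Function.Bijective Φ ∧
      (∀ (f g : C(unitInterval, ℂ)) (hf : f ∈ Cc) (hg : g ∈ Cc) (h : f + g ∈ Cc),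
        (Φ ⟨f + g, h⟩ : C₀(ℝ, ℂ)) = (Φ ⟨f, hf⟩ : C₀(ℝ, ℂ)) + (Φ ⟨g, hg⟩ : C₀(ℝ, ℂ))) ∧
      (∀ (r : ℝ) (f : C(unitInterval, ℂ)) (hf : f ∈ Cc) (h : r • f ∈ Cc),
        (Φ ⟨r • f, h⟩ : C₀(ℝ, ℂ)) = r • (Φ ⟨f, hf⟩ : C₀(ℝ, ℂ))) ∧
      (∀ (f g : C(unitInterval, ℂ)) (hf : f ∈ Cc) (hg : g ∈ Cc) (h : f * g ∈ Cc),
        (Φ ⟨f * g, h⟩ : C₀(ℝ, ℂ)) = (Φ ⟨f, hf⟩ : C₀(ℝ, ℂ)) * (Φ ⟨g, hg⟩ : C₀(ℝ, ℂ))) ∧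
      (∀ (f : C(unitInterval, ℂ)) (hf : f ∈ Cc) (h : star f ∈ Cc),
        (Φ ⟨star f, h⟩ : C₀(ℝ, ℂ)) = star (Φ ⟨f, hf⟩ : C₀(ℝ, ℂ))) := by
  open MappingCone in
  refine ⟨toSinv, ⟨toSinv_injective, toSinv_surjective⟩, ?_, ?_, ?_, ?_⟩
  · intro f g hf hg h
    ext x
    simp only [ZeroAtInftyContinuousMap.add_apply, toSinv_apply, ContinuousMap.add_apply, map_add]
    split_ifs <;> rfl
  · intro r f hf h
    ext x
    simp only [ZeroAtInftyContinuousMap.smul_apply, toSinv_apply, ContinuousMap.smul_apply]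
    split_ifs <;> simp
  · intro f g hf hg h
    ext x
    simp only [ZeroAtInftyContinuousMap.mul_apply, toSinv_apply, ContinuousMap.mul_apply, map_mul]
    split_ifs <;> rfl
  · intro f hf h
    ext x
    simp only [ZeroAtInftyContinuousMap.star_apply, toSinv_apply, ContinuousMap.star_apply]
    split_ifs <;> rfl
end

section
/- The real C*-algebra A₁ = {f ∈ C(I × I, ℂ) : f(s,0) = conj(f(s,1)) for all s ∈ I; f(0,t₁) = f(0,t₂) for all t₁, t₂ ∈ I and this common value is real; and f(1,t) = 0 for all t ∈ I} (the mapping cone of the unital inclusion ε : ℝ → T, after unfolding) is star ℝ-algebra isomorphic to the real C*-algebra B = {f ∈ C(I × I, ℂ) : f(s,0) = f(s,1) = 0 for all s ∈ I, f(1,t) = 0 for all t ∈ I, and f(0,t) = conj(f(0,1−t)) for all t ∈ I}. -/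
/-- The mapping cone of the unital inclusion `ε : ℝ → T`, unfolded:
`A₁ = {f ∈ C(I × I, ℂ) : f(s,0) = conj (f(s,1)); f(0,·) is a real constant; f(1,·) = 0}`. -/
def A1 : Set C(unitInterval × unitInterval, ℂ) :=
  {f | (∀ s : unitInterval, f (s, 0) = (starRingEnd ℂ) (f (s, 1))) ∧
       (∀ t₁ t₂ : unitInterval, f (0, t₁) = f (0, t₂)) ∧
       (∀ t : unitInterval, (f (0, t)).im = 0) ∧
       (∀ t : unitInterval, f (1, t) = 0)}

/-- `B = {f ∈ C(I × I, ℂ) : f(s,0) = f(s,1) = f(1,t) = 0, f(0,t) = conj (f(0,1−t))}`. -/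
def Bset : Set C(unitInterval × unitInterval, ℂ) :=
  {f | (∀ s : unitInterval, f (s, 0) = 0) ∧
       (∀ s : unitInterval, f (s, 1) = 0) ∧
       (∀ t : unitInterval, f (1, t) = 0) ∧
       (∀ t : unitInterval, f (0, t) = (starRingEnd ℂ) (f (0, unitInterval.symm t)))}

open unitInterval

/-- Abscissa of the path running along the bottom, right and top edges of `[0,1] × [-1,1]`. -/
noncomputable def edgeX (t : ℝ) : ℝ := min 1 (min (3 * t) (3 - 3 * t))

/-- Ordinate of the path running along the bottom, right and top edges of `[0,1] × [-1,1]`. -/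
noncomputable def edgeY (t : ℝ) : ℝ := max (-1) (min 1 (6 * t - 3))

lemma edgeX_mem {t : ℝ} (ht : t ∈ I) : 0 ≤ edgeX t ∧ edgeX t ≤ 1 := by
  obtain ⟨h0, h1⟩ := ht
  unfold edgeX
  grind

lemma edgeY_mem (t : ℝ) : -1 ≤ edgeY t ∧ edgeY t ≤ 1 := by
  unfold edgeY
  grind

lemma max_edgeX_abs_edgeY {t : ℝ} (ht : t ∈ I) : max (edgeX t) |edgeY t| = 1 := by
  obtain ⟨h0, h1⟩ := ht
  unfold edgeX edgeY
  grind

lemma edge_injective {t u : ℝ} (hx : edgeX t = edgeX u) (hy : edgeY t = edgeY u) : t = u := by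
  unfold edgeX at hx
  unfold edgeY at hy
  grind

lemma exists_edge_eq {a b : ℝ} (ha : 0 ≤ a) (h : max a |b| = 1) :
    ∃ t ∈ I, edgeX t = a ∧ edgeY t = b := by
  have ha1 : a ≤ 1 := h ▸ le_max_left _ _
  have hb1 : |b| ≤ 1 := h ▸ le_max_right _ _
  obtain ⟨hb, hb'⟩ := abs_le.1 hb1
  simp only [Set.mem_Icc, edgeX, edgeY]
  by_cases h1 : b = -1
  · clear h hb1
    exact ⟨a / 3, by constructor <;> linarith, by grind, by grind⟩
  by_cases h2 : b = 1
  · clear h hb1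
    exact ⟨1 - a / 3, by constructor <;> linarith, by grind, by grind⟩
  · have hb2 : |b| < 1 :=
      abs_lt.2 ⟨lt_of_le_of_ne hb (Ne.symm h1), lt_of_le_of_ne hb' h2⟩
    have ha2 : a = 1 := by
      rcases max_choice a |b| with h3 | h3 <;> linarith
    clear h hb1 hb2
    exact ⟨(b + 3) / 6, by constructor <;> linarith, by grind, by grind⟩

/-- Polar coordinates on the unit square centred at the midpoint `(0, 1/2)` of its left edge. -/
noncomputable def squarePolar : C(I × I, I × I) where
  toFun p :=
    (⟨p.1 * edgeX p.2, by
      have := edgeX_mem p.2.2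
      exact unitInterval.mul_mem p.1.2 this⟩,
    ⟨(1 + p.1 * edgeY p.2) / 2, by
      have h := edgeY_mem p.2
      have h0 := p.1.2.1
      have h1 := p.1.2.2
      constructor <;> nlinarith⟩)
  continuous_toFun := by
    unfold edgeX edgeY
    fun_prop

lemma squarePolar_eq_iff {p q : I × I} :
    squarePolar p = q ↔
      (p.1 * edgeX p.2 : ℝ) = q.1 ∧ (p.1 * edgeY p.2 : ℝ) = 2 * q.2 - 1 := by
  simp only [squarePolar, ContinuousMap.coe_mk, Prod.ext_iff, Subtype.ext_iff]
  constructor <;> rintro ⟨h1, h2⟩ <;> exact ⟨h1, by linarith⟩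

lemma max_squarePolar {p q : I × I} (h : squarePolar p = q) :
    max (q.1 : ℝ) |2 * (q.2 : ℝ) - 1| = p.1 := by
  obtain ⟨h1, h2⟩ := squarePolar_eq_iff.1 h
  have h0 := p.1.2.1
  rw [← h1, ← h2, abs_mul, abs_of_nonneg h0, ← mul_max_of_nonneg _ _ h0,
    max_edgeX_abs_edgeY p.2.2, mul_one]

lemma squarePolar_surjective : Function.Surjective squarePolar := by
  rintro ⟨x, y⟩
  set r : ℝ := max (x : ℝ) |2 * (y : ℝ) - 1| with hr
  have hx := x.2
  have hy := y.2
  have hr0 : 0 ≤ r := hx.1.trans (le_max_left _ _)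
  have hr1 : r ≤ 1 := max_le hx.2 (abs_le.2 ⟨by linarith [hy.1], by linarith [hy.2]⟩)
  rcases hr0.eq_or_lt with h | h
  · have h1 : (x : ℝ) = 0 := le_antisymm (h ▸ le_max_left _ _) hx.1
    have h2 : 2 * (y : ℝ) - 1 = 0 := abs_nonpos_iff.1 (h ▸ le_max_right _ _)
    exact ⟨(0, 0), squarePolar_eq_iff.2 (by simp [h1, h2])⟩
  · obtain ⟨t, ht, hX, hY⟩ := exists_edge_eq (a := x / r) (b := (2 * y - 1) / r)
      (div_nonneg hx.1 hr0)
      (by rw [abs_div, abs_of_pos h, max_div_div_right hr0, div_self h.ne'])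
    refine ⟨(⟨r, hr0, hr1⟩, ⟨t, ht⟩), squarePolar_eq_iff.2 ?_⟩
    simp only [hX, hY]
    constructor <;> field_simp

lemma squarePolar_eq_squarePolar {p q : I × I} (h : squarePolar p = squarePolar q) :
    p = q ∨ p.1 = 0 ∧ q.1 = 0 := by
  have hs : p.1 = q.1 := Subtype.ext ((max_squarePolar h).symm.trans (max_squarePolar rfl))
  by_cases h0 : q.1 = 0
  · exact Or.inr ⟨hs.trans h0, h0⟩
  · left
    obtain ⟨h1, h2⟩ := squarePolar_eq_iff.1 h
    obtain ⟨h3, h4⟩ := squarePolar_eq_iff.1 (rfl : squarePolar q = squarePolar q)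
    have hne : (q.1 : ℝ) ≠ 0 := fun e => h0 (Subtype.ext e)
    rw [← h3, hs] at h1
    rw [← h4, hs] at h2
    exact Prod.ext hs (Subtype.ext
      (edge_injective (mul_left_cancel₀ hne h1) (mul_left_cancel₀ hne h2)))

lemma squarePolar_isQuotientMap : Topology.IsQuotientMap squarePolar :=
  squarePolar.continuous.isClosedMap.isQuotientMap squarePolar.continuous squarePolar_surjective

lemma squarePolar_bottom (s : I) :
    (squarePolar (s, 0)).1 = 0 ∧ ((squarePolar (s, 0)).2 : ℝ) = (1 - s) / 2 := by
  obtain ⟨h1, h2⟩ := squarePolar_eq_iff.1 (rfl : squarePolar (s, 0) = squarePolar (s, 0))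
  norm_num [edgeX, edgeY] at h1 h2
  exact ⟨Subtype.ext h1.symm, by linarith⟩

lemma squarePolar_top (s : I) :
    (squarePolar (s, 1)).1 = 0 ∧ ((squarePolar (s, 1)).2 : ℝ) = (1 + s) / 2 := by
  obtain ⟨h1, h2⟩ := squarePolar_eq_iff.1 (rfl : squarePolar (s, 1) = squarePolar (s, 1))
  norm_num [edgeX, edgeY] at h1 h2
  exact ⟨Subtype.ext h1.symm, by linarith⟩

lemma squarePolar_bottom_eq (s : I) :
    squarePolar (s, 0) = (0, σ (squarePolar (s, 1)).2) := by
  obtain ⟨h1, h2⟩ := squarePolar_bottom s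
  obtain ⟨-, h3⟩ := squarePolar_top s
  exact Prod.ext h1 (Subtype.ext (by rw [unitInterval.coe_symm_eq, h2, h3]; ring))

lemma squarePolar_zero (t : I) : squarePolar (0, t) = squarePolar (0, 0) := by
  simp [squarePolar]

lemma squarePolar_one (t : I) :
    (squarePolar (1, t)).1 = 1 ∨ (squarePolar (1, t)).2 = 0 ∨ (squarePolar (1, t)).2 = 1 := by
  have h := max_squarePolar (rfl : squarePolar (1, t) = squarePolar (1, t))
  simp only [Subtype.ext_iff, Set.Icc.coe_zero, Set.Icc.coe_one] at h ⊢
  grind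

lemma comp_squarePolar_mem_A1 {g : C(I × I, ℂ)} (hg : g ∈ Bset) :
    g.comp squarePolar ∈ A1 := by
  obtain ⟨hbot, htop, hright, hleft⟩ := hg
  have key (s : I) : g (squarePolar (s, 0)) = starRingEnd ℂ (g (squarePolar (s, 1))) := by
    rw [squarePolar_bottom_eq, hleft, unitInterval.symm_symm]
    congr 2
    exact Prod.ext (squarePolar_top s).1.symm rfl
  refine ⟨key, fun t₁ t₂ => ?_, fun t => ?_, fun t => ?_⟩
  · simp only [ContinuousMap.comp_apply, squarePolar_zero]
  · have h := key 0
    rw [squarePolar_zero 1] at h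
    rw [ContinuousMap.comp_apply, squarePolar_zero]
    exact Complex.conj_eq_iff_im.1 h.symm
  · rw [ContinuousMap.comp_apply, ← Prod.mk.eta (p := squarePolar (1, t))]
    rcases squarePolar_one t with h | h | h <;> rw [h]
    exacts [hright _, hbot _, htop _]

lemma mem_Bset_of_comp_squarePolar_mem_A1 {g : C(I × I, ℂ)} (hg : g.comp squarePolar ∈ A1) :
    g ∈ Bset := by
  obtain ⟨hconj, -, -, hzero⟩ := hg
  have hedge (q : I × I) (hq : max (q.1 : ℝ) |2 * (q.2 : ℝ) - 1| = 1) : g q = 0 := by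
    obtain ⟨⟨s, t⟩, rfl⟩ := squarePolar_surjective q
    obtain rfl : s = 1 := Subtype.ext ((max_squarePolar rfl).symm.trans hq)
    exact hzero t
  have key (s t : I) (h : (t : ℝ) = (1 + s) / 2) :
      g (0, σ t) = starRingEnd ℂ (g (0, t)) := by
    have ht : squarePolar (s, 1) = (0, t) :=
      Prod.ext (squarePolar_top s).1 (Subtype.ext ((squarePolar_top s).2.trans h.symm))
    have := hconj s
    rwa [ContinuousMap.comp_apply, ContinuousMap.comp_apply, squarePolar_bottom_eq, ht] at this
  refine ⟨fun s => hedge _ ?_, fun s => hedge _ ?_, fun t => hedge _ ?_, fun t => ?_⟩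
  · simpa using s.2.2
  · norm_num
    exact s.2.2
  · rw [Set.Icc.coe_one]
    exact max_eq_left (abs_le.2 ⟨by linarith [t.2.1], by linarith [t.2.2]⟩)
  · rcases le_total (1 / 2 : ℝ) t with h | h
    · rw [key ⟨2 * t - 1, by linarith, by linarith [t.2.2]⟩ t (by simp), Complex.conj_conj]
    · have := key ⟨1 - 2 * t, by linarith, by linarith [t.2.1]⟩ (σ t)
        (by simp only [unitInterval.coe_symm_eq]; ring)
      rwa [unitInterval.symm_symm] at this

/-- Pulling back along `squarePolar` identifies `Bset` with `A1`. -/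
noncomputable def squarePolarPullback : Bset ≃ A1 :=
  Equiv.ofBijective (fun g => ⟨g.1.comp squarePolar, comp_squarePolar_mem_A1 g.2⟩) <| by
    constructor
    · intro g₁ g₂ h
      exact Subtype.ext ((ContinuousMap.cancel_right squarePolar_surjective).1
        (congrArg Subtype.val h))
    · rintro ⟨f, hf⟩
      have hfib (p q : I × I) (h : squarePolar p = squarePolar q) : f p = f q := by
        rcases squarePolar_eq_squarePolar h with rfl | ⟨hp, hq⟩
        · rfl
        · rw [← Prod.mk.eta (p := p), ← Prod.mk.eta (p := q), hp, hq]
          exact hf.2.1 _ _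
      have hlift := squarePolar_isQuotientMap.lift_comp f hfib
      exact ⟨⟨squarePolar_isQuotientMap.lift f hfib,
        mem_Bset_of_comp_squarePolar_mem_A1 (by rwa [hlift])⟩, Subtype.ext hlift⟩

lemma squarePolarPullback_symm_comp (f : A1) :
    (squarePolarPullback.symm f : C(I × I, ℂ)).comp squarePolar = f :=
  congrArg Subtype.val (squarePolarPullback.apply_symm_apply f)

lemma squarePolarPullback_symm_eq {f : A1} {g : C(I × I, ℂ)} (h : g.comp squarePolar = f) :
    (squarePolarPullback.symm f : C(I × I, ℂ)) = g :=
  (ContinuousMap.cancel_right squarePolar_surjective).1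
    ((squarePolarPullback_symm_comp f).trans h.symm)


/-- `A₁` is star `ℝ`-algebra isomorphic to `B`. -/
theorem stmt_6 :
    ∃ Φ : ↥A1 → ↥Bset,
      Function.Bijective Φ ∧
      (∀ (f g : C(unitInterval × unitInterval, ℂ)) (hf : f ∈ A1) (hg : g ∈ A1)
          (h : f + g ∈ A1),
        (Φ ⟨f + g, h⟩ : C(unitInterval × unitInterval, ℂ)) =
          (Φ ⟨f, hf⟩ : C(unitInterval × unitInterval, ℂ)) + (Φ ⟨g, hg⟩ :
            C(unitInterval × unitInterval, ℂ))) ∧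
      (∀ (r : ℝ) (f : C(unitInterval × unitInterval, ℂ)) (hf : f ∈ A1) (h : r • f ∈ A1),
        (Φ ⟨r • f, h⟩ : C(unitInterval × unitInterval, ℂ)) =
          r • (Φ ⟨f, hf⟩ : C(unitInterval × unitInterval, ℂ))) ∧
      (∀ (f g : C(unitInterval × unitInterval, ℂ)) (hf : f ∈ A1) (hg : g ∈ A1)
          (h : f * g ∈ A1),
        (Φ ⟨f * g, h⟩ : C(unitInterval × unitInterval, ℂ)) =
          (Φ ⟨f, hf⟩ : C(unitInterval × unitInterval, ℂ)) * (Φ ⟨g, hg⟩ :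
            C(unitInterval × unitInterval, ℂ))) ∧
      (∀ (f : C(unitInterval × unitInterval, ℂ)) (hf : f ∈ A1) (h : star f ∈ A1),
        (Φ ⟨star f, h⟩ : C(unitInterval × unitInterval, ℂ)) =
          star (Φ ⟨f, hf⟩ : C(unitInterval × unitInterval, ℂ))) := by
  refine ⟨squarePolarPullback.symm, squarePolarPullback.symm.bijective, ?_, ?_, ?_, ?_⟩
  · intro f g hf hg h
    apply squarePolarPullback_symm_eq
    rw [ContinuousMap.add_comp, squarePolarPullback_symm_comp, squarePolarPullback_symm_comp]
  · intro r f hf h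
    apply squarePolarPullback_symm_eq
    rw [ContinuousMap.smul_comp, squarePolarPullback_symm_comp]
  · intro f g hf hg h
    apply squarePolarPullback_symm_eq
    rw [ContinuousMap.mul_comp, squarePolarPullback_symm_comp, squarePolarPullback_symm_comp]
  · intro f hf h
    apply squarePolarPullback_symm_eq
    exact congrArg star (squarePolarPullback_symm_comp ⟨f, hf⟩)
end

section
/- Let S¹ = {z ∈ ℂ : |z| = 1} be the unit circle and let ι ∈ C(S¹, ℂ) be the inclusion function ι(z) = z. Then the topological closure (with respect to the supremum norm) of the star ℝ-subalgebra of C(S¹, ℂ) generated by ι equals the real C*-algebra C(S¹; conj) = {f ∈ C(S¹, ℂ) : f(conj(z)) = conj(f(z)) for all z ∈ S¹}. -/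
/-- The inclusion function `ι(z) = z` on the unit circle `S¹ = {z : ℂ : |z| = 1}`. -/
noncomputable def iotaMap : C(Metric.sphere (0 : ℂ) 1, ℂ) :=
  ⟨fun z => (z : ℂ), continuous_subtype_val⟩

/-- Complex conjugation as a continuous self-map of the unit circle. -/
noncomputable def circleConj : C(Metric.sphere (0 : ℂ) 1, Metric.sphere (0 : ℂ) 1) where
  toFun z := ⟨starRingEnd ℂ z, by
    have hz := z.2
    rw [mem_sphere_zero_iff_norm] at hz ⊢
    rwa [RCLike.norm_conj]⟩
  continuous_toFun := by fun_prop

/-- The involution `f ↦ (z ↦ conj (f (conj z)))` of `C(S¹, ℂ)`. -/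
noncomputable def conjTwist (f : C(Metric.sphere (0 : ℂ) 1, ℂ)) :
    C(Metric.sphere (0 : ℂ) 1, ℂ) :=
  star (f.comp circleConj)

theorem conjTwist_apply (f : C(Metric.sphere (0 : ℂ) 1, ℂ)) (z : Metric.sphere (0 : ℂ) 1) :
    conjTwist f z = starRingEnd ℂ (f (circleConj z)) := rfl

theorem circleConj_circleConj (z : Metric.sphere (0 : ℂ) 1) :
    circleConj (circleConj z) = z :=
  Subtype.ext (Complex.conj_conj (z : ℂ))

theorem continuous_conjTwist : Continuous conjTwist :=
  continuous_star.comp (ContinuousMap.continuous_precomp circleConj)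

theorem conjTwist_eq_self_iff (f : C(Metric.sphere (0 : ℂ) 1, ℂ)) :
    conjTwist f = f ↔ ∀ z w : Metric.sphere (0 : ℂ) 1,
      (w : ℂ) = (starRingEnd ℂ) (z : ℂ) → f w = (starRingEnd ℂ) (f z) := by
  constructor
  · intro h z w hw
    obtain rfl : w = circleConj z := Subtype.ext hw
    rw [← DFunLike.congr_fun h (circleConj z), conjTwist_apply, circleConj_circleConj]
  · intro h
    ext z
    rw [conjTwist_apply, h z (circleConj z) rfl, Complex.conj_conj]

theorem conjTwist_eq_self_of_mem_adjoin {f : C(Metric.sphere (0 : ℂ) 1, ℂ)}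
    (hf : f ∈ StarAlgebra.adjoin ℝ {iotaMap}) : conjTwist f = f := by
  induction hf using StarAlgebra.adjoin_induction with
  | mem x hx =>
    obtain rfl := hx
    ext z
    exact Complex.conj_conj (z : ℂ)
  | algebraMap r =>
    ext z
    exact Complex.conj_ofReal r
  | add x y _ _ hx hy =>
    ext z
    have h₁ := DFunLike.congr_fun hx z
    have h₂ := DFunLike.congr_fun hy z
    rw [conjTwist_apply] at *
    simp [h₁, h₂]
  | mul x y _ _ hx hy =>
    ext z
    have h₁ := DFunLike.congr_fun hx z
    have h₂ := DFunLike.congr_fun hy z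
    rw [conjTwist_apply] at *
    simp [h₁, h₂]
  | star x _ hx =>
    ext z
    have h₁ := DFunLike.congr_fun hx z
    rw [conjTwist_apply] at *
    simp [← h₁]

/-- The complex star subalgebra generated by `ι` is the complexification of the real one. -/
theorem exists_add_I_smul_of_mem_adjoin {f : C(Metric.sphere (0 : ℂ) 1, ℂ)}
    (hf : f ∈ StarAlgebra.adjoin ℂ {iotaMap}) :
    ∃ a ∈ StarAlgebra.adjoin ℝ {iotaMap}, ∃ b ∈ StarAlgebra.adjoin ℝ {iotaMap},
      f = a + Complex.I • b := by
  induction hf using StarAlgebra.adjoin_induction with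
  | mem x hx => exact ⟨x, StarAlgebra.subset_adjoin ℝ _ hx, 0, zero_mem _, by simp⟩
  | algebraMap r =>
    refine ⟨algebraMap ℝ _ r.re, algebraMap_mem _ _, algebraMap ℝ _ r.im, algebraMap_mem _ _, ?_⟩
    ext z
    change r = (r.re : ℂ) + Complex.I * (r.im : ℂ)
    rw [mul_comm, Complex.re_add_im]
  | add x y _ _ hx hy =>
    obtain ⟨a, ha, b, hb, rfl⟩ := hx
    obtain ⟨c, hc, d, hd, rfl⟩ := hy
    exact ⟨a + c, add_mem ha hc, b + d, add_mem hb hd, by rw [smul_add]; abel⟩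
  | mul x y _ _ hx hy =>
    obtain ⟨a, ha, b, hb, rfl⟩ := hx
    obtain ⟨c, hc, d, hd, rfl⟩ := hy
    refine ⟨a * c - b * d, sub_mem (mul_mem ha hc) (mul_mem hb hd), a * d + b * c,
      add_mem (mul_mem ha hd) (mul_mem hb hc), ?_⟩
    ext z
    simp only [ContinuousMap.mul_apply, ContinuousMap.add_apply, ContinuousMap.sub_apply,
      ContinuousMap.smul_apply, smul_eq_mul]
    linear_combination (b z * d z) * Complex.I_mul_I
  | star x _ hx =>
    obtain ⟨a, ha, b, hb, rfl⟩ := hx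
    exact ⟨star a, star_mem ha, -star b, neg_mem (star_mem hb), by simp [star_smul]⟩

/-- The real-linear projection of `C(S¹, ℂ)` onto the fixed points of `conjTwist`. -/
noncomputable def conjTwistAverage (f : C(Metric.sphere (0 : ℂ) 1, ℂ)) :
    C(Metric.sphere (0 : ℂ) 1, ℂ) :=
  (2⁻¹ : ℂ) • (f + conjTwist f)

theorem continuous_conjTwistAverage : Continuous conjTwistAverage :=
  Continuous.const_smul (continuous_id.add continuous_conjTwist) (2⁻¹ : ℂ)

theorem conjTwistAverage_add_I_smul {a b : C(Metric.sphere (0 : ℂ) 1, ℂ)}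
    (ha : conjTwist a = a) (hb : conjTwist b = b) :
    conjTwistAverage (a + Complex.I • b) = a := by
  ext z
  have h₁ := DFunLike.congr_fun ha z
  have h₂ := DFunLike.congr_fun hb z
  rw [conjTwist_apply] at h₁ h₂
  simp only [conjTwistAverage, ContinuousMap.smul_apply, ContinuousMap.add_apply,
    conjTwist_apply, smul_eq_mul, map_add, map_mul, Complex.conj_I, h₁, h₂]
  ring

theorem closure_adjoin_complex_iotaMap :
    closure (StarAlgebra.adjoin ℂ {iotaMap} : Set C(Metric.sphere (0 : ℂ) 1, ℂ)) = Set.univ := by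
  have h := ContinuousMap.starSubalgebra_topologicalClosure_eq_top_of_separatesPoints
    (StarAlgebra.adjoin ℂ {iotaMap}) fun x y hxy =>
      ⟨iotaMap, ⟨iotaMap, StarAlgebra.self_mem_adjoin_singleton ℂ iotaMap, rfl⟩,
        fun h => hxy (Subtype.ext h)⟩
  rw [← StarSubalgebra.topologicalClosure_coe, h, StarSubalgebra.coe_top]

/-- The sup-norm closure of the star `ℝ`-subalgebra of `C(S¹, ℂ)` generated by `ι`
equals `C(S¹; conj) = {f : f (conj z) = conj (f z)}`. -/
theorem stmt_12 :
    closure ((StarAlgebra.adjoin ℝ {iotaMap} :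
        StarSubalgebra ℝ C(Metric.sphere (0 : ℂ) 1, ℂ)) : Set C(Metric.sphere (0 : ℂ) 1, ℂ)) =
      {f : C(Metric.sphere (0 : ℂ) 1, ℂ) |
        ∀ z w : Metric.sphere (0 : ℂ) 1,
          (w : ℂ) = (starRingEnd ℂ) (z : ℂ) → f w = (starRingEnd ℂ) (f z)} := by
  simp only [← conjTwist_eq_self_iff]
  refine (closure_minimal (fun f hf => conjTwist_eq_self_of_mem_adjoin hf)
    (isClosed_eq continuous_conjTwist continuous_id)).antisymm fun f hf => ?_
  have hmaps : Set.MapsTo conjTwistAverage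
      (StarAlgebra.adjoin ℂ {iotaMap} : Set C(Metric.sphere (0 : ℂ) 1, ℂ))
      (StarAlgebra.adjoin ℝ {iotaMap} : Set C(Metric.sphere (0 : ℂ) 1, ℂ)) := by
    intro g hg
    obtain ⟨a, ha, b, hb, rfl⟩ := exists_add_I_smul_of_mem_adjoin hg
    rwa [conjTwistAverage_add_I_smul (conjTwist_eq_self_of_mem_adjoin ha)
      (conjTwist_eq_self_of_mem_adjoin hb)]
  have hfix : conjTwistAverage f = f := by
    have h0 : conjTwist 0 = 0 := conjTwist_eq_self_of_mem_adjoin (zero_mem _)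
    simpa using conjTwistAverage_add_I_smul hf h0
  rw [← hfix]
  exact hmaps.closure continuous_conjTwistAverage
    (closure_adjoin_complex_iotaMap ▸ Set.mem_univ f)
end

section
/- Let r : ℂ → M₂(ℝ) be r(x + iy) = [[x, −y],[y, x]], let M(z) ∈ M₄(ℝ) be the block matrix with r(z) in the upper-left 2 × 2 block and zeros elsewhere, let P ∈ M₄(ℝ) be the permutation matrix swapping coordinates 1 ↔ 2 and 3 ↔ 4, and let u : I → M₄(ℝ) be a continuous map with each u(s) orthogonal, u(0) = 1 and u(1) = P. For f ∈ T define σ₁(f) : I → M₄(ℝ) by σ₁(f)(x) = M(f(2x)) for x ≤ 1/2 and σ₁(f)(x) = u(2x−1) · M(f(1)) · u(2x−1)ᵀ for x ≥ 1/2. Then: (1) the two formulas agree at x = 1/2, so σ₁(f) is a well-defined continuous map; (2) σ₁(f)(0) = σ₁(f)(1) = M(f(0)), so σ₁(f) is a loop; (3) σ₁ : T → C(I, M₄(ℝ)) is an ℝ-algebra homomorphism; and (4) σ₁(star f)(x) = (σ₁(f)(x))ᵀ for all f ∈ T and x ∈ I. -/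
open Matrix

/-- `M z`: the matrix with `r z = [[Re z, −Im z],[Im z, Re z]]` in the upper-left
`2 × 2` block and zeros elsewhere. -/
def Mz (z : ℂ) : Matrix (Fin 4) (Fin 4) ℝ :=
  !![z.re, -z.im, 0, 0; z.im, z.re, 0, 0; 0, 0, 0, 0; 0, 0, 0, 0]

/-- The permutation matrix swapping coordinates 1 ↔ 2 and 3 ↔ 4. -/
def P4 : Matrix (Fin 4) (Fin 4) ℝ :=
  !![0, 1, 0, 0; 1, 0, 0, 0; 0, 0, 0, 1; 0, 0, 1, 0]

theorem Mz_add (z w : ℂ) : Mz (z + w) = Mz z + Mz w := by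
  ext i j
  fin_cases i <;> fin_cases j <;> simp [Mz, add_comm]

theorem Mz_smul (r : ℝ) (z : ℂ) : Mz (r • z) = r • Mz z := by
  ext i j
  fin_cases i <;> fin_cases j <;> simp [Mz]

theorem Mz_mul (z w : ℂ) : Mz (z * w) = Mz z * Mz w := by
  ext i j
  fin_cases i <;> fin_cases j <;>
    simp [Mz, Matrix.mul_apply, Fin.sum_univ_four] <;> ring

theorem Mz_star (z : ℂ) : Mz (star z) = (Mz z)ᵀ := by
  ext i j
  fin_cases i <;> fin_cases j <;> simp [Mz]

theorem P4_conj_Mz (z : ℂ) : P4 * Mz z * P4ᵀ = Mz (star z) := by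
  ext i j
  fin_cases i <;> fin_cases j <;>
    simp [Mz, P4, Matrix.mul_apply, Fin.sum_univ_four]

theorem continuous_Mz : Continuous Mz := by
  refine continuous_matrix fun i j => ?_
  fin_cases i <;> fin_cases j <;> simp [Mz] <;> fun_prop

/-- The reparametrization `x ↦ 2x` of the unit interval, clamped at `1`. -/
noncomputable def clampedDouble (x : unitInterval) : unitInterval :=
  Set.projIcc 0 1 zero_le_one (2 * (x : ℝ))

/-- The reparametrization `x ↦ 2x - 1` of the unit interval, clamped at `0`. -/
noncomputable def clampedDoubleSubOne (x : unitInterval) : unitInterval :=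
  Set.projIcc 0 1 zero_le_one (2 * (x : ℝ) - 1)

theorem continuous_clampedDouble : Continuous clampedDouble :=
  continuous_projIcc.comp (by fun_prop)

theorem continuous_clampedDoubleSubOne : Continuous clampedDoubleSubOne :=
  continuous_projIcc.comp (by fun_prop)

theorem clampedDouble_eq {x y : unitInterval} (h : (y : ℝ) = 2 * (x : ℝ)) :
    clampedDouble x = y := by
  rw [clampedDouble, ← h, Set.projIcc_val]

theorem clampedDouble_eq_one {x : unitInterval} (h : 1 ≤ 2 * (x : ℝ)) :
    clampedDouble x = 1 :=
  Set.projIcc_of_right_le _ h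

theorem clampedDoubleSubOne_eq {x y : unitInterval} (h : (y : ℝ) = 2 * (x : ℝ) - 1) :
    clampedDoubleSubOne x = y := by
  rw [clampedDoubleSubOne, ← h, Set.projIcc_val]

theorem clampedDoubleSubOne_eq_zero {x : unitInterval} (h : 2 * (x : ℝ) ≤ 1) :
    clampedDoubleSubOne x = 0 :=
  Set.projIcc_of_le_left _ (by linarith)

/-- The map `x ↦ u(2x - 1) · M (f (2x)) · u(2x - 1)ᵀ`, with both arguments clamped to the
unit interval. For `u 0 = 1` it is the concatenation of `M ∘ f` with the conjugation of
`M (f 1)` along `u`. -/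
noncomputable def conjugationPath (u : C(unitInterval, Matrix (Fin 4) (Fin 4) ℝ)) (f : C(unitInterval, ℂ)) :
    C(unitInterval, Matrix (Fin 4) (Fin 4) ℝ) where
  toFun x := u (clampedDoubleSubOne x) * Mz (f (clampedDouble x)) * (u (clampedDoubleSubOne x))ᵀ
  continuous_toFun := by
    have hu := u.continuous.comp continuous_clampedDoubleSubOne
    have hf := continuous_Mz.comp (f.continuous.comp continuous_clampedDouble)
    exact (hu.matrix_mul hf).matrix_mul hu.matrix_transpose

theorem conjugationPath_apply (u : C(unitInterval, Matrix (Fin 4) (Fin 4) ℝ))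
    (f : C(unitInterval, ℂ)) (x : unitInterval) :
    conjugationPath u f x =
      u (clampedDoubleSubOne x) * Mz (f (clampedDouble x)) * (u (clampedDoubleSubOne x))ᵀ :=
  rfl

theorem conjugationPath_of_le_half {u : C(unitInterval, Matrix (Fin 4) (Fin 4) ℝ)}
    (hu0 : u 0 = 1) (f : C(unitInterval, ℂ)) {x y : unitInterval} (hx : 2 * (x : ℝ) ≤ 1)
    (hy : (y : ℝ) = 2 * (x : ℝ)) : conjugationPath u f x = Mz (f y) := by
  simp [conjugationPath_apply, clampedDoubleSubOne_eq_zero hx, clampedDouble_eq hy, hu0]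

theorem conjugationPath_of_half_le (u : C(unitInterval, Matrix (Fin 4) (Fin 4) ℝ))
    (f : C(unitInterval, ℂ)) {x s : unitInterval} (hx : 1 ≤ 2 * (x : ℝ))
    (hs : (s : ℝ) = 2 * (x : ℝ) - 1) :
    conjugationPath u f x = u s * Mz (f 1) * (u s)ᵀ := by
  rw [conjugationPath_apply, clampedDoubleSubOne_eq hs, clampedDouble_eq_one hx]

/-- Given a continuous path `u` of orthogonal matrices from `1` to `P4`, the map
`σ₁(f)(x) = M (f (2x))` for `x ≤ 1/2` and `σ₁(f)(x) = u(2x−1) · M (f 1) · u(2x−1)ᵀ`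
for `x ≥ 1/2` is a well-defined continuous loop based at `M (f 0)`, and
`σ₁ : T → C(I, M₄(ℝ))` is an `ℝ`-algebra homomorphism with
`σ₁(star f)(x) = (σ₁(f)(x))ᵀ`. -/
theorem stmt_14 (u : C(unitInterval, Matrix (Fin 4) (Fin 4) ℝ))
    (hu : ∀ s : unitInterval, (u s)ᵀ * u s = 1) (hu0 : u 0 = 1) (hu1 : u 1 = P4) :
    ∃ σ : {f : C(unitInterval, ℂ) // f ∈ T} → C(unitInterval, Matrix (Fin 4) (Fin 4) ℝ),
      (∀ (f : {f : C(unitInterval, ℂ) // f ∈ T}) (x x' : unitInterval),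
        2 * (x : ℝ) ≤ 1 → (x' : ℝ) = 2 * (x : ℝ) → σ f x = Mz (f.1 x')) ∧
      (∀ (f : {f : C(unitInterval, ℂ) // f ∈ T}) (x s : unitInterval),
        1 ≤ 2 * (x : ℝ) → (s : ℝ) = 2 * (x : ℝ) - 1 →
          σ f x = u s * Mz (f.1 1) * (u s)ᵀ) ∧
      (∀ f : {f : C(unitInterval, ℂ) // f ∈ T}, σ f 0 = Mz (f.1 0) ∧ σ f 1 = Mz (f.1 0)) ∧
      (∀ (f g : C(unitInterval, ℂ)) (hf : f ∈ T) (hg : g ∈ T) (h : f + g ∈ T)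
          (x : unitInterval),
        σ ⟨f + g, h⟩ x = σ ⟨f, hf⟩ x + σ ⟨g, hg⟩ x) ∧
      (∀ (r : ℝ) (f : C(unitInterval, ℂ)) (hf : f ∈ T) (h : r • f ∈ T) (x : unitInterval),
        σ ⟨r • f, h⟩ x = r • σ ⟨f, hf⟩ x) ∧
      (∀ (f g : C(unitInterval, ℂ)) (hf : f ∈ T) (hg : g ∈ T) (h : f * g ∈ T)
          (x : unitInterval),
        σ ⟨f * g, h⟩ x = σ ⟨f, hf⟩ x * σ ⟨g, hg⟩ x) ∧
      (∀ (f : C(unitInterval, ℂ)) (hf : f ∈ T) (h : star f ∈ T) (x : unitInterval),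
        σ ⟨star f, h⟩ x = (σ ⟨f, hf⟩ x)ᵀ) := by
  refine ⟨fun f => conjugationPath u f.1,
    fun f x y hx hy => conjugationPath_of_le_half hu0 f.1 hx hy,
    fun f x s hx hs => conjugationPath_of_half_le u f.1 hx hs, fun f => ⟨?_, ?_⟩, ?_, ?_, ?_, ?_⟩
  · exact conjugationPath_of_le_half hu0 f.1 (by simp) (by simp)
  · have hf : f.1 0 = star (f.1 1) := f.2
    rw [conjugationPath_of_half_le u f.1 (s := 1) (by norm_num) (by norm_num), hu1,
      P4_conj_Mz, hf]
  · intro f g _ _ _ x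
    simp only [conjugationPath_apply, ContinuousMap.add_apply, Mz_add, mul_add, add_mul]
  · intro r f _ _ x
    simp only [conjugationPath_apply, ContinuousMap.smul_apply, Mz_smul, mul_smul_comm,
      smul_mul_assoc]
  · intro f g _ _ _ x
    simp only [conjugationPath_apply, ContinuousMap.mul_apply, Mz_mul]
    set v := u (clampedDoubleSubOne x)
    have hvv : vᵀ * v = 1 := hu _
    simp only [mul_assoc]
    rw [← mul_assoc vᵀ v, hvv, one_mul]
  · intro f _ _ x
    simp only [conjugationPath_apply, ContinuousMap.star_apply, Mz_star, transpose_mul,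
      transpose_transpose, mul_assoc]
end
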